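/- Let A and B be coprime integers, set N₀ = A⁴ + 16·B⁴, and let p be an odd prime dividing N₀. Then there exist y, z in the field ℚ_p of p-adic numbers with 2·y² = z⁴ − N₀. -/

import Mathlib

/-- If `-16` is a fourth power ratio modulo an odd prime `p`, then `2⁻¹` is a square modulo `p`. -/
theorem ZMod.exists_two_mul_sq_eq_one {p : ℕ} [Fact p.Prime] (h2 : (2 : ZMod p) ≠ 0)
    {a b : ZMod p} (hb : b ≠ 0) (h : a ^ 4 + 16 * b ^ 4 = 0) :
    ∃ y : ZMod p, 2 * y ^ 2 = 1 := by
  obtain ⟨t, ht⟩ : ∃ t : ZMod p, t ^ 4 = -1 := by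
    refine ⟨a / (2 * b), ?_⟩
    rw [div_pow, div_eq_iff (pow_ne_zero _ (mul_ne_zero h2 hb))]
    linear_combination h
  refine ⟨(t - t ^ 3) / 2, ?_⟩
  field_simp
  linear_combination (t ^ 2 - 2) * ht

/-- Hensel lifting for `2y² = c` at an odd prime. -/
theorem PadicInt.exists_two_mul_sq_eq {p : ℕ} [Fact p.Prime] {a c : ℤ}
    (h : (p : ℤ) ∣ 2 * a ^ 2 - c) (ha : ¬ (p : ℤ) ∣ 4 * a) :
    ∃ y : ℤ_[p], 2 * y ^ 2 = c := by
  have h_two : ∀ x : ℤ_[p], Polynomial.aeval x (2 : Polynomial ℤ) = 2 := fun x => map_ofNat _ 2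
  let F : Polynomial ℤ := 2 * Polynomial.X ^ 2 - Polynomial.C c
  have hF : ∀ x : ℤ_[p], Polynomial.aeval x F = 2 * x ^ 2 - c := by
    intro x
    simp [F, h_two]
  have hF' : Polynomial.aeval (a : ℤ_[p]) F.derivative = ((4 * a : ℤ) : ℤ_[p]) := by
    simp [F, Polynomial.derivative_pow, h_two]
    ring
  have hderiv : ‖Polynomial.aeval (a : ℤ_[p]) F.derivative‖ = 1 := by
    rw [hF']
    refine le_antisymm (PadicInt.norm_le_one _) (not_lt.mp fun hlt => ha ?_)
    exact PadicInt.norm_int_lt_one_iff_dvd _ |>.mp hlt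
  have hnorm : ‖Polynomial.aeval (a : ℤ_[p]) F‖ < 1 := by
    rw [hF]
    exact_mod_cast PadicInt.norm_int_lt_one_iff_dvd (p := p) (2 * a ^ 2 - c) |>.mpr h
  obtain ⟨y, hy, -⟩ := hensels_lemma (F := F) (a := (a : ℤ_[p])) (by rwa [hderiv, one_pow])
  exact ⟨y, sub_eq_zero.mp ((hF y).symm.trans hy)⟩


/-- For coprime integers `A`, `B` and an odd prime `p` dividing `N₀ = A⁴ + 16B⁴`,
the twisted Reichardt–Lind equation `2y² = z⁴ − N₀` has a solution in `ℚ_p`. -/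
theorem twisted_reichardt_lind_Qp_point
    (A B : ℤ) (hAB : IsCoprime A B) (p : ℕ) [Fact p.Prime] (hodd : Odd p)
    (hdvd : (p : ℤ) ∣ A ^ 4 + 16 * B ^ 4) :
    ∃ y z : ℚ_[p], 2 * y ^ 2 = z ^ 4 - ((A ^ 4 + 16 * B ^ 4 : ℤ) : ℚ_[p]) := by

  have hp : Prime (p : ℤ) := Nat.prime_iff_prime_int.mp Fact.out
  have h2 : (2 : ZMod p) ≠ 0 := by
    have := (ZMod.natCast_eq_zero_iff 2 p).not.mpr fun h => by
      have := (Nat.prime_dvd_prime_iff_eq Fact.out Nat.prime_two).mp h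
      subst this
      exact absurd hodd (by decide)
    exact_mod_cast this
  have hB : (B : ZMod p) ≠ 0 := by
    rw [Ne, ZMod.intCast_zmod_eq_zero_iff_dvd]
    intro hB
    have hA : (p : ℤ) ∣ A := hp.dvd_of_dvd_pow
      ((Int.dvd_add_left ((dvd_pow hB four_ne_zero).mul_left 16)).mp hdvd)
    exact hp.not_isUnit (hAB.isUnit_of_dvd' hA hB)
  have hN : (A : ZMod p) ^ 4 + 16 * (B : ZMod p) ^ 4 = 0 := by
    exact_mod_cast (ZMod.intCast_zmod_eq_zero_iff_dvd _ p).mpr hdvd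
  obtain ⟨y₀, hy₀⟩ := ZMod.exists_two_mul_sq_eq_one h2 hB hN
  obtain ⟨a, rfl⟩ := ZMod.intCast_surjective y₀
  obtain ⟨y, hy⟩ := PadicInt.exists_two_mul_sq_eq (p := p) (a := a)
    (c := 1 - (A ^ 4 + 16 * B ^ 4))
    (by
      rw [← ZMod.intCast_zmod_eq_zero_iff_dvd]
      push_cast
      linear_combination hy₀ + hN)
    (by
      rw [← ZMod.intCast_zmod_eq_zero_iff_dvd]
      push_cast
      intro h
      apply h2
      linear_combination (a : ZMod p) * h - 2 * hy₀)
  refine ⟨y, 1, ?_⟩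
  have hy' := congrArg (PadicInt.Coe.ringHom (p := p)) hy
  rw [map_mul, map_pow, map_ofNat, map_intCast] at hy'
  refine hy'.trans ?_
  push_cast
  ring
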